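/- arXiv:2110.14099 — 6 statements merged into one kernel-verified Lean document; each statement's English description precedes it below -/
import Mathlib

section
/- Let δ ∈ (0,1) and μ ∈ (0,1). Let X_1, X_2, … be random variables with 0 ≤ X_i ≤ 1 almost surely and E[X_i | X_1,…,X_{i-1}] = μ for every i. Then P( ∃ t ≥ 1 : sup_{β ∈ [-1/(1-μ), 1/μ]} Σ_{i=1}^t ln(1 + β (X_i - μ)) - ln( √π · Γ(t+1) / Γ(t + 1/2) ) ≥ ln(1/δ) ) ≤ δ, where Γ is the Gamma function. -/
open MeasureTheory
open scoped BigOperators Real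

/-- The extended-real logarithm, with the convention `ln x = -∞` for `x ≤ 0`. -/
noncomputable def elog (x : ℝ) : EReal :=
  if x ≤ 0 then ⊥ else ((Real.log x : ℝ) : EReal)

/-- The normalized Gamma value `Γ(n + 1/2) / √π`, written as a product. -/
noncomputable def halfRising (n : ℕ) : ℝ := ∏ i ∈ Finset.range n, ((i : ℝ) + 1 / 2)

lemma halfRising_succ (n : ℕ) : halfRising (n + 1) = halfRising n * (n + 1 / 2) :=
  Finset.prod_range_succ _ _

lemma halfRising_pos (n : ℕ) : 0 < halfRising n :=
  Finset.prod_pos fun _ _ => by positivity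

lemma Gamma_add_half_eq_halfRising (n : ℕ) :
    Real.Gamma (n + 1 / 2) = Real.sqrt π * halfRising n := by
  induction n with
  | zero => simp only [Nat.cast_zero, zero_add, Real.Gamma_one_half_eq, halfRising,
      Finset.range_zero, Finset.prod_empty, mul_one]
  | succ n ih =>
    rw [halfRising_succ, ← mul_assoc, ← ih, mul_comm, ← Real.Gamma_add_one (by positivity)]
    congr 1
    push_cast
    ring

lemma antitoneOn_log_add_half_add_mul_log :
    AntitoneOn (fun x : ℝ => Real.log (x + 1 / 2) + x * Real.log x - (x + 1) * Real.log (x + 1))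
      (Set.Ici 0) := by
  have hderiv : ∀ x : ℝ, 0 < x → HasDerivAt
      (fun x : ℝ => Real.log (x + 1 / 2) + x * Real.log x - (x + 1) * Real.log (x + 1))
      (1 / (x + 1 / 2) + (Real.log x + 1) - (Real.log (x + 1) + 1)) x := by
    intro x hx
    have h1 : HasDerivAt (fun x : ℝ => Real.log (x + 1 / 2)) (1 / (x + 1 / 2)) x :=
      ((hasDerivAt_id x).add_const (1 / 2)).log (by simp only [id]; positivity)
    have h2 := Real.hasDerivAt_mul_log hx.ne'
    have h3 : HasDerivAt (fun x : ℝ => (x + 1) * Real.log (x + 1)) (Real.log (x + 1) + 1) x :=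
      HasDerivAt.comp_add_const x 1 (Real.hasDerivAt_mul_log (by positivity))
    exact (h1.add h2).sub h3
  apply antitoneOn_of_deriv_nonpos (convex_Ici 0)
  · refine ContinuousOn.sub (ContinuousOn.add ?_ ?_) ?_
    · refine ContinuousOn.log (by fun_prop) fun x hx => ?_
      have : (0 : ℝ) ≤ x := hx
      positivity
    · exact Real.continuous_mul_log.continuousOn
    · exact (Real.continuous_mul_log.comp (continuous_add_const 1)).continuousOn
  · intro x hx
    rw [interior_Ici] at hx
    exact (hderiv x hx).differentiableAt.differentiableWithinAt
  · intro x hx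
    rw [interior_Ici] at hx
    have hx : 0 < x := hx
    rw [(hderiv x hx).deriv]
    have h := Real.le_log_one_add_of_nonneg (x := x⁻¹) (by positivity)
    have h1 : 2 * x⁻¹ / (x⁻¹ + 2) = 1 / (x + 1 / 2) := by field_simp; ring
    have h2 : Real.log (1 + x⁻¹) = Real.log (x + 1) - Real.log x := by
      rw [← Real.log_div (by positivity) (by positivity)]
      congr 1
      field_simp
    rw [h1, h2] at h
    linarith

lemma add_half_mul_pow_self_mul_le {k n : ℕ} (hkn : k ≤ n) :
    ((n : ℝ) + 1 / 2) * (n : ℝ) ^ n * ((k : ℝ) + 1) ^ (k + 1) ≤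
      ((k : ℝ) + 1 / 2) * (k : ℝ) ^ k * ((n : ℝ) + 1) ^ (n + 1) := by
  have key : ∀ m : ℕ, Real.exp (Real.log (m + 1 / 2) + m * Real.log m
      - (m + 1) * Real.log (m + 1)) = (m + 1 / 2) * (m : ℝ) ^ m / ((m : ℝ) + 1) ^ (m + 1) := by
    intro m
    have h : ((m : ℝ) + 1) * Real.log (m + 1) = (m + 1 : ℕ) * Real.log ((m : ℝ) + 1) := by
      push_cast; ring
    rw [Real.exp_sub, Real.exp_add, Real.exp_log (by positivity), h, Real.exp_nat_mul,
      Real.exp_nat_mul, Real.exp_log (by positivity : (0 : ℝ) < m + 1)]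
    congr 2
    rcases m.eq_zero_or_pos with rfl | hm
    · simp
    · rw [Real.exp_log (Nat.cast_pos.2 hm)]
  have h := antitoneOn_log_add_half_add_mul_log (Set.mem_Ici.2 k.cast_nonneg)
    (Set.mem_Ici.2 n.cast_nonneg) (Nat.cast_le.2 hkn : (k : ℝ) ≤ n)
  have h := Real.exp_le_exp.2 h
  simp only [key] at h
  rwa [div_le_div_iff₀ (by positivity) (by positivity)] at h

lemma natCast_pow_self_pos (n : ℕ) : 0 < (n : ℝ) ^ n := by
  exact_mod_cast Nat.pow_self_pos

lemma pow_self_mul_halfRising_add_le (k l : ℕ) :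
    (k : ℝ) ^ k * (l : ℝ) ^ l * halfRising (k + l) ≤
      halfRising k * halfRising l * ((k + l : ℕ) : ℝ) ^ (k + l) := by
  induction k with
  | zero => simp [halfRising, mul_comm]
  | succ k ih =>
    have hg := add_half_mul_pow_self_mul_le (Nat.le_add_right k l)
    have hk := natCast_pow_self_pos k
    have hn := natCast_pow_self_pos (k + l)
    have hl := natCast_pow_self_pos l
    have h1 := halfRising_pos k
    have h2 := halfRising_pos l
    have h3 := halfRising_pos (k + l)
    have hmul := mul_le_mul ih hg (by positivity) (by positivity)
    rw [show k + 1 + l = k + l + 1 by ring, halfRising_succ, halfRising_succ]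
    refine le_of_mul_le_mul_left ?_ (mul_pos hk hn)
    push_cast at hmul ⊢
    calc _ = _ := by ring
      _ ≤ _ := hmul
      _ = _ := by ring

lemma mul_pow_le_pow_self_mul_exp (k : ℕ) {x : ℝ} (hx : 0 ≤ x) :
    x ^ k ≤ (k : ℝ) ^ k * Real.exp (x - k) := by
  rcases k.eq_zero_or_pos with rfl | hk
  · simpa using hx
  · have hk' : (0 : ℝ) < k := by exact_mod_cast hk
    have h : x / k ≤ Real.exp (x / k - 1) := by
      have := Real.add_one_le_exp (x / k - 1)
      linarith
    calc x ^ k = (k : ℝ) ^ k * (x / k) ^ k := by rw [← mul_pow, mul_div_cancel₀ _ hk'.ne']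
      _ ≤ (k : ℝ) ^ k * Real.exp (x / k - 1) ^ k := by gcongr
      _ = _ := by
        rw [← Real.exp_nat_mul]
        congr 2
        field_simp

lemma pow_mul_one_sub_pow_mul_halfRising_add_le (k l : ℕ) {b : ℝ} (hb0 : 0 ≤ b) (hb1 : b ≤ 1) :
    b ^ k * (1 - b) ^ l * halfRising (k + l) ≤ halfRising k * halfRising l := by
  have hb : 0 ≤ 1 - b := by linarith
  have h1 := mul_pow_le_pow_self_mul_exp k (x := (k + l : ℕ) * b) (by positivity)
  have h2 := mul_pow_le_pow_self_mul_exp l (x := (k + l : ℕ) * (1 - b)) (by positivity)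
  have h3 := mul_le_mul h1 h2 (by positivity) (by positivity)
  have hn := natCast_pow_self_pos (k + l)
  have h4 : b ^ k * (1 - b) ^ l * ((k + l : ℕ) : ℝ) ^ (k + l) ≤ (k : ℝ) ^ k * (l : ℝ) ^ l := by
    calc _ = (((k + l : ℕ) : ℝ) * b) ^ k * (((k + l : ℕ) : ℝ) * (1 - b)) ^ l := by
          rw [mul_pow, mul_pow, pow_add]; ring
      _ ≤ _ := h3
      _ = (k : ℝ) ^ k * (l : ℝ) ^ l *
          Real.exp (((k + l : ℕ) * b - k) + ((k + l : ℕ) * (1 - b) - l)) := by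
          rw [Real.exp_add]; ring
      _ = _ := by
          have : ((k + l : ℕ) * b - k) + ((k + l : ℕ) * (1 - b) - l) = (0 : ℝ) := by
            push_cast; ring
          rw [this, Real.exp_zero, mul_one]
  have h5 := pow_self_mul_halfRising_add_le k l
  have h6 := halfRising_pos (k + l)
  refine le_of_mul_le_mul_right ?_ hn
  calc _ = b ^ k * (1 - b) ^ l * ((k + l : ℕ) : ℝ) ^ (k + l) * halfRising (k + l) := by ring
    _ ≤ (k : ℝ) ^ k * (l : ℝ) ^ l * halfRising (k + l) := by gcongr
    _ ≤ _ := h5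

/-- For a parameter `p` with the `Beta(1/2, 1/2)` distribution, the expectation of
`p ^ k * (1 - p) ^ l` times the wealth after `t` rounds of the portfolio with constant weight `p`,
when the two assets have returns `x i / μ` and `(1 - x i) / (1 - μ)`. -/
noncomputable def mixtureWealth (μ : ℝ) (x : ℕ → ℝ) : ℕ → ℕ → ℕ → ℝ
  | 0, k, l => halfRising k * halfRising l / (k + l).factorial
  | t + 1, k, l => x t / μ * mixtureWealth μ x t (k + 1) l +
      (1 - x t) / (1 - μ) * mixtureWealth μ x t k (l + 1)

lemma mixtureWealth_eq_add (μ : ℝ) (x : ℕ → ℝ) (t k l : ℕ) :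
    mixtureWealth μ x t k l = mixtureWealth μ x t (k + 1) l + mixtureWealth μ x t k (l + 1) := by
  induction t generalizing k l with
  | zero =>
    simp only [mixtureWealth, halfRising_succ]
    rw [show k + 1 + l = k + l + 1 by ring, show k + (l + 1) = k + l + 1 by ring,
      Nat.factorial_succ]
    have : ((k + l).factorial : ℝ) ≠ 0 := by positivity
    push_cast
    field_simp
    ring
  | succ t ih =>
    simp only [mixtureWealth]
    rw [ih (k + 1) l, ih k (l + 1)]
    ring

lemma mixtureWealth_succ_eq {μ : ℝ} (hμ0 : 0 < μ) (hμ1 : μ < 1) (x : ℕ → ℝ) (t k l : ℕ) :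
    mixtureWealth μ x (t + 1) k l = mixtureWealth μ x t k l +
      (mixtureWealth μ x t (k + 1) l / μ - mixtureWealth μ x t k (l + 1) / (1 - μ)) *
        (x t - μ) := by
  have h : 1 - μ ≠ 0 := by linarith
  rw [mixtureWealth_eq_add μ x t k l, mixtureWealth]
  field_simp
  ring

lemma mixtureWealth_nonneg {μ : ℝ} (hμ0 : 0 < μ) (hμ1 : μ < 1) {x : ℕ → ℝ}
    (hx : ∀ i, x i ∈ Set.Icc (0 : ℝ) 1) (t k l : ℕ) : 0 ≤ mixtureWealth μ x t k l := by
  induction t generalizing k l with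
  | zero =>
    have h1 := halfRising_pos k
    have h2 := halfRising_pos l
    simp only [mixtureWealth]
    positivity
  | succ t ih =>
    have h1 := (hx t).1
    have h2 := sub_nonneg.2 (hx t).2
    have h3 := sub_pos.2 hμ1
    have h4 := ih (k + 1) l
    have h5 := ih k (l + 1)
    simp only [mixtureWealth]
    positivity

/-- The regret bound for the `Beta(1/2, 1/2)` mixture of constant portfolios. -/
lemma pow_mul_prod_mul_le_mixtureWealth {μ : ℝ} (hμ0 : 0 < μ) (hμ1 : μ < 1) {x : ℕ → ℝ}
    (hx : ∀ i, x i ∈ Set.Icc (0 : ℝ) 1) {b : ℝ} (hb0 : 0 ≤ b) (hb1 : b ≤ 1) (t k l : ℕ) :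
    b ^ k * (1 - b) ^ l *
        (∏ i ∈ Finset.range t, (b * (x i / μ) + (1 - b) * ((1 - x i) / (1 - μ)))) *
        (halfRising (t + k + l) / (t + k + l).factorial) ≤ mixtureWealth μ x t k l := by
  induction t generalizing k l with
  | zero =>
    simp only [Finset.range_zero, Finset.prod_empty, mul_one, zero_add, mixtureWealth]
    rw [← mul_div_assoc]
    refine div_le_div_of_nonneg_right ?_ (by positivity)
    exact pow_mul_one_sub_pow_mul_halfRising_add_le k l hb0 hb1
  | succ t ih =>
    have h1 : 0 ≤ x t / μ := div_nonneg (hx t).1 hμ0.le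
    have h2 : 0 ≤ (1 - x t) / (1 - μ) := div_nonneg (sub_nonneg.2 (hx t).2) (sub_nonneg.2 hμ1.le)
    have h3 := mul_le_mul_of_nonneg_left (ih (k + 1) l) h1
    have h4 := mul_le_mul_of_nonneg_left (ih k (l + 1)) h2
    rw [show t + (k + 1) + l = t + 1 + k + l by ring] at h3
    rw [show t + k + (l + 1) = t + 1 + k + l by ring] at h4
    rw [mixtureWealth, Finset.prod_range_succ]
    refine le_trans (le_of_eq ?_) (add_le_add h3 h4)
    ring

lemma prod_one_add_mul_le_mixtureWealth {μ : ℝ} (hμ0 : 0 < μ) (hμ1 : μ < 1) {x : ℕ → ℝ}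
    (hx : ∀ i, x i ∈ Set.Icc (0 : ℝ) 1) {β : ℝ} (hβ : β ∈ Set.Icc (-(1 / (1 - μ))) (1 / μ))
    (t : ℕ) :
    ∏ i ∈ Finset.range t, (1 + β * (x i - μ)) ≤
      Real.sqrt π * Real.Gamma (t + 1) / Real.Gamma (t + 1 / 2) * mixtureWealth μ x t 0 0 := by
  have h1 : 0 < 1 - μ := sub_pos.2 hμ1
  have hβ1 : -1 ≤ β * (1 - μ) := by
    have := mul_le_mul_of_nonneg_right hβ.1 h1.le
    rwa [neg_mul, one_div_mul_cancel h1.ne'] at this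
  have hβ2 : β * μ ≤ 1 := by
    have := mul_le_mul_of_nonneg_right hβ.2 hμ0.le
    rwa [one_div_mul_cancel hμ0.ne'] at this
  have h := pow_mul_prod_mul_le_mixtureWealth hμ0 hμ1 hx (b := μ + β * (1 - μ) * μ)
    (by nlinarith) (by nlinarith) t 0 0
  simp only [pow_zero, one_mul, add_zero] at h
  have hfac : ∀ i ∈ Finset.range t, (μ + β * (1 - μ) * μ) * (x i / μ) +
      (1 - (μ + β * (1 - μ) * μ)) * ((1 - x i) / (1 - μ)) = 1 + β * (x i - μ) := by
    intro i _
    field_simp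
    ring
  rw [Finset.prod_congr rfl hfac] at h
  have ha := halfRising_pos t
  have hπ : 0 < Real.sqrt π := Real.sqrt_pos.2 Real.pi_pos
  rw [Gamma_add_half_eq_halfRising, Real.Gamma_nat_eq_factorial, mul_div_mul_left _ _ hπ.ne']
  have hf : (0 : ℝ) < t.factorial := by positivity
  rw [← mul_div_assoc, div_le_iff₀ hf] at h
  rw [div_mul_eq_mul_div, le_div_iff₀ ha]
  linarith

lemma elog_mul {x y : ℝ} (hx : 0 ≤ x) (hy : 0 ≤ y) : elog (x * y) = elog x + elog y := by
  rcases hx.eq_or_lt with rfl | hx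
  · simp [elog]
  rcases hy.eq_or_lt with rfl | hy
  · simp [elog]
  rw [elog, elog, elog, if_neg (mul_pos hx hy).not_ge, if_neg hx.not_ge, if_neg hy.not_ge,
    Real.log_mul hx.ne' hy.ne', EReal.coe_add]

lemma sum_elog {ι : Type*} (s : Finset ι) {f : ι → ℝ} (hf : ∀ i, 0 ≤ f i) :
    ∑ i ∈ s, elog (f i) = elog (∏ i ∈ s, f i) := by
  classical
  induction s using Finset.induction_on with
  | empty => simp [elog]
  | insert a s ha ih =>
    rw [Finset.sum_insert ha, Finset.prod_insert ha, ih,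
      elog_mul (hf a) (Finset.prod_nonneg fun i _ => hf i)]

lemma elog_le_log {x y : ℝ} (hxy : x ≤ y) : elog x ≤ (Real.log y : EReal) := by
  rw [elog]
  split_ifs with h
  · exact bot_le
  · exact EReal.coe_le_coe_iff.2 (Real.log_le_log (not_le.1 h) hxy)

lemma one_add_mul_sub_nonneg {μ : ℝ} (hμ0 : 0 < μ) (hμ1 : μ < 1) {x β : ℝ}
    (hx : x ∈ Set.Icc (0 : ℝ) 1) (hβ : β ∈ Set.Icc (-(1 / (1 - μ))) (1 / μ)) :
    0 ≤ 1 + β * (x - μ) := by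
  have h1 : 0 < 1 - μ := sub_pos.2 hμ1
  have hβ1 : -1 ≤ β * (1 - μ) := by
    have := mul_le_mul_of_nonneg_right hβ.1 h1.le
    rwa [neg_mul, one_div_mul_cancel h1.ne'] at this
  have hβ2 : β * μ ≤ 1 := by
    have := mul_le_mul_of_nonneg_right hβ.2 hμ0.le
    rwa [one_div_mul_cancel hμ0.ne'] at this
  nlinarith [mul_nonneg hx.1 (by linarith : 0 ≤ 1 + β * (1 - μ)),
    mul_nonneg (sub_nonneg.2 hx.2) (by linarith : 0 ≤ 1 - β * μ)]

lemma le_mixtureWealth_of_log_le {μ δ : ℝ} (hδ : 0 < δ) (hμ0 : 0 < μ) (hμ1 : μ < 1) {x : ℕ → ℝ}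
    (hx : ∀ i, x i ∈ Set.Icc (0 : ℝ) 1) {t : ℕ}
    (h : ((Real.log (1 / δ) : ℝ) : EReal) ≤
          (⨆ β ∈ Set.Icc (-(1 / (1 - μ))) (1 / μ),
              ∑ i ∈ Finset.range t, elog (1 + β * (x i - μ)))
            - ((Real.log (Real.sqrt π * Real.Gamma (t + 1) /
                Real.Gamma (t + 1 / 2)) : ℝ) : EReal)) :
    1 / δ ≤ mixtureWealth μ x t 0 0 := by
  have hR : 0 < Real.sqrt π * Real.Gamma (t + 1) / Real.Gamma (t + 1 / 2) := by
    have h1 : 0 < Real.Gamma ((t : ℝ) + 1) := Real.Gamma_pos_of_pos (by positivity)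
    have h2 : 0 < Real.Gamma ((t : ℝ) + 1 / 2) := Real.Gamma_pos_of_pos (by positivity)
    have hπ : 0 < Real.sqrt π := Real.sqrt_pos.2 Real.pi_pos
    positivity
  set R := Real.sqrt π * Real.Gamma (t + 1) / Real.Gamma (t + 1 / 2) with hRdef
  have h1 : 0 < 1 - μ := sub_pos.2 hμ1
  have hW : 0 < mixtureWealth μ x t 0 0 := by
    have h0 := prod_one_add_mul_le_mixtureWealth hμ0 hμ1 hx (β := 0)
      ⟨by rw [neg_nonpos]; positivity, by positivity⟩ t
    simp only [zero_mul, add_zero, Finset.prod_const_one] at h0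
    exact pos_of_mul_pos_right (zero_lt_one.trans_le h0) hR.le
  have hsup : (⨆ β ∈ Set.Icc (-(1 / (1 - μ))) (1 / μ),
      ∑ i ∈ Finset.range t, elog (1 + β * (x i - μ))) ≤
        ((Real.log (R * mixtureWealth μ x t 0 0) : ℝ) : EReal) := by
    refine iSup₂_le fun β hβ => ?_
    rw [sum_elog _ fun i => one_add_mul_sub_nonneg hμ0 hμ1 (hx i) hβ]
    exact elog_le_log (prod_one_add_mul_le_mixtureWealth hμ0 hμ1 hx hβ t)
  have h2 := h.trans (EReal.sub_le_sub hsup le_rfl)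
  rw [← EReal.coe_sub, EReal.coe_le_coe_iff, Real.log_mul hR.ne' hW.ne', add_sub_cancel_left,
    Real.log_le_log_iff (by positivity) hW] at h2
  exact h2

/-- Ville's inequality for nonnegative martingales in discrete time. -/
lemma MeasureTheory.Martingale.measure_exists_le_le {Ω : Type*} {m0 : MeasurableSpace Ω}
    {P : Measure Ω} [IsFiniteMeasure P] {𝒢 : Filtration ℕ m0} {f : ℕ → Ω → ℝ}
    (hf : Martingale f 𝒢 P) (hnonneg : 0 ≤ f) {c : ℝ} (hc : 0 < c) :
    P {ω | ∃ n, c ≤ f n ω} ≤ ENNReal.ofReal ((∫ ω, f 0 ω ∂P) / c) := by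
  have hset : {ω | ∃ n, c ≤ f n ω} = ⋃ n, {ω | c ≤
      (Finset.range (n + 1)).sup' Finset.nonempty_range_add_one fun k => f k ω} := by
    ext ω
    simp only [Set.mem_ofPred_eq, Set.mem_iUnion, Finset.le_sup'_iff, Finset.mem_range]
    exact ⟨fun ⟨n, hn⟩ => ⟨n, n, n.lt_succ_self, hn⟩, fun ⟨_, n, _, hn⟩ => ⟨n, hn⟩⟩
  have hmono : Monotone fun n => {ω | c ≤
      (Finset.range (n + 1)).sup' Finset.nonempty_range_add_one fun k => f k ω} := by
    intro m n hmn ω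
    simp only [Set.mem_ofPred_eq, Finset.le_sup'_iff, Finset.mem_range]
    rintro ⟨k, hk, h⟩
    exact ⟨k, by omega, h⟩
  rw [hset, hmono.measure_iUnion]
  refine iSup_le fun n => ?_
  have h := maximal_ineq hf.submartingale hnonneg (ε := ⟨c, hc.le⟩) n
  have hint : ∫ ω in {ω | c ≤ (Finset.range (n + 1)).sup' Finset.nonempty_range_add_one
      fun k => f k ω}, f n ω ∂P ≤ ∫ ω, f 0 ω ∂P := by
    refine (setIntegral_le_integral (hf.integrable n) (ae_of_all _ (hnonneg n))).trans_eq ?_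
    rw [← integral_condExp (𝒢.le 0)]
    exact integral_congr_ae (hf.2 0 n n.zero_le)
  have h' := h.trans (ENNReal.ofReal_le_ofReal hint)
  rw [ENNReal.ofReal_div_of_pos hc, ENNReal.le_div_iff_mul_le (by simp [hc]) (by simp), mul_comm]
  rwa [ENNReal.ofReal_eq_coe_nnreal hc.le]

section AdaptedReturns

variable {Ω : Type*} {m0 : MeasurableSpace Ω} {P : Measure Ω} {𝒢 : Filtration ℕ m0}
  {Y : ℕ → Ω → ℝ} {μ : ℝ}

lemma stronglyMeasurable_mixtureWealth (hY : StronglyAdapted 𝒢 Y) {n t : ℕ} (ht : t ≤ n + 1)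
    (k l : ℕ) : StronglyMeasurable[𝒢 n] fun ω => mixtureWealth μ (fun i => Y i ω) t k l := by
  induction t generalizing k l with
  | zero => exact stronglyMeasurable_const
  | succ t ih =>
    have h := (hY t).mono (𝒢.mono (by omega : t ≤ n))
    have h1 := ih (by omega) (k + 1) l
    have h2 := ih (by omega) k (l + 1)
    simp only [mixtureWealth, div_eq_mul_inv]
    exact ((h.mul_const _).mul h1).add (((stronglyMeasurable_const.sub h).mul_const _).mul h2)

lemma exists_forall_mixtureWealth_le (hμ0 : 0 < μ) (hμ1 : μ < 1) (t k l : ℕ) :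
    ∃ C, ∀ x : ℕ → ℝ, (∀ i, x i ∈ Set.Icc (0 : ℝ) 1) → mixtureWealth μ x t k l ≤ C := by
  induction t generalizing k l with
  | zero => exact ⟨_, fun x _ => le_rfl⟩
  | succ t ih =>
    obtain ⟨C, hC⟩ := ih (k + 1) l
    obtain ⟨D, hD⟩ := ih k (l + 1)
    have hμ1' := sub_pos.2 hμ1
    refine ⟨1 / μ * C + 1 / (1 - μ) * D, fun x hx => ?_⟩
    have h1 := mixtureWealth_nonneg hμ0 hμ1 hx t (k + 1) l
    have h2 := mixtureWealth_nonneg hμ0 hμ1 hx t k (l + 1)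
    rw [mixtureWealth]
    gcongr
    · exact (hx t).2
    · exact hC x hx
    · linarith [(hx t).1]
    · exact hD x hx

lemma integrable_mixtureWealth [IsFiniteMeasure P] (hμ0 : 0 < μ) (hμ1 : μ < 1)
    (hY : StronglyAdapted 𝒢 Y) (hY01 : ∀ i ω, Y i ω ∈ Set.Icc (0 : ℝ) 1) (t k l : ℕ) :
    Integrable (fun ω => mixtureWealth μ (fun i => Y i ω) t k l) P := by
  obtain ⟨C, hC⟩ := exists_forall_mixtureWealth_le hμ0 hμ1 t k l
  refine Integrable.of_bound ((stronglyMeasurable_mixtureWealth hY t.le_succ k l).mono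
    (𝒢.le t)).aestronglyMeasurable C (ae_of_all _ fun ω => ?_)
  rw [Real.norm_of_nonneg (mixtureWealth_nonneg hμ0 hμ1 (fun i => hY01 i ω) t k l)]
  exact hC _ fun i => hY01 i ω

lemma martingale_mixtureWealth [IsProbabilityMeasure P] (hμ0 : 0 < μ) (hμ1 : μ < 1)
    (hY : StronglyAdapted 𝒢 Y) (hY01 : ∀ i ω, Y i ω ∈ Set.Icc (0 : ℝ) 1)
    (hmean : ∀ i, P[Y (i + 1) | 𝒢 i] =ᵐ[P] fun _ => μ) :
    Martingale (fun n ω => mixtureWealth μ (fun i => Y i ω) (n + 1) 0 0) 𝒢 P := by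
  refine martingale_nat (fun n => stronglyMeasurable_mixtureWealth hY le_rfl 0 0)
    (fun n => integrable_mixtureWealth hμ0 hμ1 hY hY01 _ 0 0) fun n => ?_
  set W : Ω → ℝ := fun ω => mixtureWealth μ (fun i => Y i ω) (n + 1) 0 0 with hW
  set D : Ω → ℝ := fun ω => mixtureWealth μ (fun i => Y i ω) (n + 1) 1 0 / μ -
    mixtureWealth μ (fun i => Y i ω) (n + 1) 0 1 / (1 - μ) with hD
  have hWm : StronglyMeasurable[𝒢 n] W := stronglyMeasurable_mixtureWealth hY le_rfl 0 0
  have hWi : Integrable W P := integrable_mixtureWealth hμ0 hμ1 hY hY01 _ 0 0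
  have hDm : StronglyMeasurable[𝒢 n] D := by
    simp only [hD, div_eq_mul_inv]
    exact ((stronglyMeasurable_mixtureWealth hY le_rfl 1 0).mul_const _).sub
      ((stronglyMeasurable_mixtureWealth hY le_rfl 0 1).mul_const _)
  have hDi : Integrable D P :=
    ((integrable_mixtureWealth hμ0 hμ1 hY hY01 _ 1 0).div_const _).sub
      ((integrable_mixtureWealth hμ0 hμ1 hY hY01 _ 0 1).div_const _)
  have hYm : AEStronglyMeasurable (Y (n + 1)) P := ((hY (n + 1)).mono (𝒢.le _)).aestronglyMeasurable
  have hYb : ∀ ω, ‖Y (n + 1) ω‖ ≤ 1 := fun ω => by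
    rw [Real.norm_of_nonneg (hY01 _ ω).1]; exact (hY01 _ ω).2
  have hYi : Integrable (Y (n + 1)) P := Integrable.of_bound hYm 1 (ae_of_all _ hYb)
  have hZi : Integrable (Y (n + 1) - fun _ => μ) P := hYi.sub (integrable_const μ)
  have hDZi : Integrable (D * (Y (n + 1) - fun _ => μ)) P := by
    refine hDi.mul_bdd (c := 1 + ‖μ‖) hZi.aestronglyMeasurable (ae_of_all _ fun ω => ?_)
    exact (norm_sub_le _ _).trans (add_le_add (hYb ω) le_rfl)
  have hsucc : (fun ω => mixtureWealth μ (fun i => Y i ω) (n + 1 + 1) 0 0) =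
      W + D * (Y (n + 1) - fun _ => μ) :=
    funext fun ω => mixtureWealth_succ_eq hμ0 hμ1 _ _ 0 0
  rw [hsucc]
  have hZ : P[Y (n + 1) - fun _ => μ | 𝒢 n] =ᵐ[P] 0 := by
    filter_upwards [condExp_sub hYi (integrable_const μ) (𝒢 n), hmean n] with ω h1 h2
    rw [h1, Pi.sub_apply, h2, condExp_const (𝒢.le n)]
    simp
  filter_upwards [condExp_add hWi hDZi (𝒢 n),
    condExp_mul_of_stronglyMeasurable_left hDm hDZi hZi, hZ] with ω h1 h2 h3
  rw [h1, Pi.add_apply, h2, condExp_of_stronglyMeasurable (𝒢.le n) hWm hWi, Pi.mul_apply, h3]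
  simp

lemma integral_mixtureWealth_one [IsProbabilityMeasure P] (hμ0 : 0 < μ) (hμ1 : μ < 1)
    (hY : Integrable (Y 0) P) (hmean : ∫ ω, Y 0 ω ∂P = μ) :
    ∫ ω, mixtureWealth μ (fun i => Y i ω) 1 0 0 ∂P = 1 := by
  have h1 : 1 - μ ≠ 0 := by linarith
  have h : ∀ ω, mixtureWealth μ (fun i => Y i ω) 1 0 0 =
      1 + (1 / 2 / μ - 1 / 2 / (1 - μ)) * (Y 0 ω - μ) := by
    intro ω
    rw [mixtureWealth_succ_eq hμ0 hμ1]
    simp [mixtureWealth, halfRising]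
  simp_rw [h]
  have hZ : Integrable (fun ω => Y 0 ω - μ) P := hY.sub (integrable_const μ)
  rw [integral_add (integrable_const _) (hZ.const_mul _),
    integral_const_mul, integral_sub hY (integrable_const μ), hmean]
  simp

end AdaptedReturns

/-- Time-uniform portfolio-regret concentration.  Let `δ ∈ (0,1)`,
`μ ∈ (0,1)`, and let `X 0, X 1, …` (representing `X_1, X_2, …`) be random
variables with values in `[0,1]` a.s. and conditional mean
`E[X_i | X_1,…,X_{i-1}] = μ` (so `E[X 0] = μ`, and the conditional
expectation of `X (i+1)` given the natural filtration at time `i` is `μ`).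
Then with probability at least `1 - δ`, for all `t ≥ 1`,
`sup_{β ∈ [-1/(1-μ), 1/μ]} Σ_{i<t} ln(1 + β (X_i - μ))
  - ln(√π Γ(t+1)/Γ(t+1/2)) < ln(1/δ)` (logs with `ln 0 = -∞`). -/
theorem portfolio_regret_concentration {Ω : Type*} {m0 : MeasurableSpace Ω}
    {P : Measure Ω} [IsProbabilityMeasure P]
    (X : ℕ → Ω → ℝ) (hX : ∀ i, StronglyMeasurable (X i))
    (δ μ : ℝ) (hδ0 : 0 < δ) (hδ1 : δ < 1) (hμ0 : 0 < μ) (hμ1 : μ < 1)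
    (hbdd : ∀ i, ∀ᵐ ω ∂P, X i ω ∈ Set.Icc (0 : ℝ) 1)
    (hmean0 : ∫ ω, X 0 ω ∂P = μ)
    (hmean : ∀ i, P[X (i + 1) | (Filtration.natural X hX) i]
      =ᵐ[P] fun _ => μ) :
    P {ω | ∃ t : ℕ, 1 ≤ t ∧
        ((Real.log (1 / δ) : ℝ) : EReal) ≤
          (⨆ β ∈ Set.Icc (-(1 / (1 - μ))) (1 / μ),
              ∑ i ∈ Finset.range t, elog (1 + β * (X i ω - μ)))
            - ((Real.log (Real.sqrt π * Real.Gamma (t + 1) /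
                Real.Gamma (t + 1 / 2)) : ℝ) : EReal)}
      ≤ ENNReal.ofReal δ := by
  set Y : ℕ → Ω → ℝ := fun i ω => max 0 (min 1 (X i ω)) with hYdef
  have hY01 : ∀ i ω, Y i ω ∈ Set.Icc (0 : ℝ) 1 := fun i ω =>
    ⟨le_max_left _ _, max_le zero_le_one (min_le_left _ _)⟩
  have hYad : StronglyAdapted (Filtration.natural X hX) Y := fun i =>
    ((continuous_const.max (continuous_const.min continuous_id)).comp_stronglyMeasurable
      (Filtration.stronglyAdapted_natural hX i))
  have hXY : ∀ i ω, X i ω ∈ Set.Icc (0 : ℝ) 1 → Y i ω = X i ω := fun i ω h => by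
    simp only [hYdef]
    rw [min_eq_right h.2, max_eq_right h.1]
  have hae : ∀ i, Y i =ᵐ[P] X i := fun i => (hbdd i).mono (hXY i)
  have hmeanY : ∀ i, P[Y (i + 1) | (Filtration.natural X hX) i] =ᵐ[P] fun _ => μ := fun i =>
    (condExp_congr_ae (hae (i + 1))).trans (hmean i)
  have hmeanY0 : ∫ ω, Y 0 ω ∂P = μ := (integral_congr_ae (hae 0)).trans hmean0
  have hYi : Integrable (Y 0) P := by
    refine Integrable.of_bound ((hYad 0).mono ((Filtration.natural X hX).le 0)).aestronglyMeasurable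
      1 (ae_of_all _ fun ω => ?_)
    rw [Real.norm_of_nonneg (hY01 _ ω).1]
    exact (hY01 _ ω).2
  have hville := (martingale_mixtureWealth hμ0 hμ1 hYad hY01 hmeanY).measure_exists_le_le
    (fun n ω => mixtureWealth_nonneg hμ0 hμ1 (fun i => hY01 i ω) (n + 1) 0 0)
    (one_div_pos.2 hδ0)
  simp only [zero_add, integral_mixtureWealth_one hμ0 hμ1 hYi hmeanY0, one_div_one_div] at hville
  refine (measure_mono_ae ?_).trans hville
  filter_upwards [ae_all_iff.2 hbdd] with ω hω
  rintro ⟨t, ht, h⟩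
  obtain ⟨n, rfl⟩ := Nat.exists_eq_add_of_le' ht
  have hYX : (fun i => Y i ω) = fun i => X i ω := funext fun i => hXY i ω (hω i)
  refine ⟨n, ?_⟩
  rw [hYX]
  exact le_mixtureWealth_of_log_le hδ0 hμ0 hμ1 hω h
end

section
/- Let X_1,…,X_t ∈ [0,1], let μ̂_t = (1/t) Σ_{i=1}^t X_i, and let μ ∈ (0,1). Then sup_{β ∈ [-1/(1-μ), 1/μ]} Σ_{i=1}^t ln(1 + β (X_i - μ)) ≥ t · D(μ̂_t, μ), where D(p,q) = p ln(p/q) + (1-p) ln((1-p)/(1-q)) is the Bernoulli KL divergence. Moreover, equality holds whenever every X_i ∈ {0,1}. -/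
open scoped BigOperators

/-- The Bernoulli Kullback–Leibler divergence
`D(p,q) = p ln(p/q) + (1-p) ln((1-p)/(1-q))` (with `0 · ln 0 = 0`). -/
noncomputable def bernoulliKL (p q : ℝ) : ℝ :=
  p * Real.log (p / q) + (1 - p) * Real.log ((1 - p) / (1 - q))

theorem coe_le_elog {x c : ℝ} (hx : 0 < x) (h : c ≤ Real.log x) : (c : EReal) ≤ elog x := by
  rw [elog, if_neg hx.not_ge]
  exact_mod_cast h

theorem elog_le_tangent {v : ℝ} (y : ℝ) (hv : 0 < v) :
    elog y ≤ ((Real.log v + (y / v - 1) : ℝ) : EReal) := by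
  unfold elog
  split_ifs with hy
  · exact bot_le
  · push Not at hy
    have h := Real.log_le_sub_one_of_pos (div_pos hy hv)
    rw [Real.log_div hy.ne' hv.ne'] at h
    exact_mod_cast (by linarith : Real.log y ≤ Real.log v + (y / v - 1))

theorem ereal_coe_sum {ι : Type*} (s : Finset ι) (f : ι → ℝ) :
    ((∑ i ∈ s, f i : ℝ) : EReal) = ∑ i ∈ s, (f i : EReal) := by
  classical
  induction s using Finset.induction_on with
  | empty => simp
  | insert a s ha ih => rw [Finset.sum_insert ha, Finset.sum_insert ha, EReal.coe_add, ih]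

theorem sum_mul_add_one_sub_mul {t : ℕ} {X : Fin t → ℝ} {p : ℝ} (hp : ∑ i, X i = t * p)
    (a b : ℝ) : ∑ i, (X i * a + (1 - X i) * b) = t * (p * a + (1 - p) * b) := by
  rw [Finset.sum_add_distrib, ← Finset.sum_mul, ← Finset.sum_mul, Finset.sum_sub_distrib, hp]
  simp
  ring

/-- Concavity of the logarithm along the log-optimal bet `β = (p - μ) / (μ (1 - μ))`. -/
theorem chord_le_elog_wealth {p μ x : ℝ} (hμ0 : 0 < μ) (hμ1 : μ < 1) (hp0 : 0 ≤ p) (hp1 : p ≤ 1)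
    (hx0 : 0 ≤ x) (hx1 : x ≤ 1) (h0 : p = 0 → x = 0) (h1 : p = 1 → x = 1) :
    ((x * Real.log (p / μ) + (1 - x) * Real.log ((1 - p) / (1 - μ)) : ℝ) : EReal)
      ≤ elog (1 + (p - μ) / (μ * (1 - μ)) * (x - μ)) := by
  have hμ1' : 0 < 1 - μ := sub_pos.2 hμ1
  have e : 1 + (p - μ) / (μ * (1 - μ)) * (x - μ)
      = x * (p / μ) + (1 - x) * ((1 - p) / (1 - μ)) := by
    field_simp
    ring
  rw [e]
  rcases hp0.eq_or_lt with hp | hp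
  · have hx := h0 hp.symm
    subst hx
    subst hp
    exact coe_le_elog (by simpa using hμ1) (by simp)
  rcases hp1.eq_or_lt with hq | hq
  · have hx := h1 hq
    subst hx
    subst hq
    exact coe_le_elog (by simpa using hμ0) (by simp)
  have ha : 0 < p / μ := div_pos hp hμ0
  have hb : 0 < (1 - p) / (1 - μ) := div_pos (sub_pos.2 hq) hμ1'
  refine coe_le_elog ?_ ?_
  · rcases hx0.eq_or_lt with hx | hx
    · rw [← hx]
      simpa using hb
    · have := mul_pos hx ha
      have := mul_nonneg (sub_nonneg.2 hx1) hb.le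
      linarith
  · have := strictConcaveOn_log_Ioi.concaveOn.2 (Set.mem_Ioi.2 ha) (Set.mem_Ioi.2 hb) hx0
      (sub_nonneg.2 hx1) (by ring)
    simpa only [smul_eq_mul] using this

/-- For `X_1,…,X_t ∈ [0,1]` with empirical mean `μ̂`, and `μ ∈ (0,1)`,
`sup_{β ∈ [-1/(1-μ), 1/μ]} Σ_i ln(1 + β (X_i - μ)) ≥ t · D(μ̂, μ)`
(with `ln 0 = -∞`), with equality whenever every `X_i ∈ {0,1}`. -/
theorem max_log_wealth_ge_kl (t : ℕ) (ht : 1 ≤ t) (X : Fin t → ℝ)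
    (hX : ∀ i, X i ∈ Set.Icc (0 : ℝ) 1) (μ : ℝ) (hμ0 : 0 < μ) (hμ1 : μ < 1) :
    ((((t : ℝ) * bernoulliKL ((∑ i, X i) / t) μ : ℝ) : EReal)
      ≤ ⨆ β ∈ Set.Icc (-(1 / (1 - μ))) (1 / μ), ∑ i, elog (1 + β * (X i - μ))) ∧
    ((∀ i, X i = 0 ∨ X i = 1) →
      (⨆ β ∈ Set.Icc (-(1 / (1 - μ))) (1 / μ), ∑ i, elog (1 + β * (X i - μ)))
        = (((t : ℝ) * bernoulliKL ((∑ i, X i) / t) μ : ℝ) : EReal)) := by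
  have ht' : (0 : ℝ) < t := by exact_mod_cast ht
  have hμ1' : 0 < 1 - μ := sub_pos.2 hμ1
  set p : ℝ := (∑ i, X i) / t with hp_def
  have hp : ∑ i, X i = t * p := by
    rw [hp_def]
    field_simp
  have hle (i : Fin t) : X i ≤ t * p := by
    rw [← hp]
    exact Finset.single_le_sum (f := X) (fun j _ => (hX j).1) (Finset.mem_univ i)
  have hle' (i : Fin t) : 1 - X i ≤ t * (1 - p) := by
    have h := Finset.single_le_sum (f := fun j => 1 - X j) (fun j _ => sub_nonneg.2 (hX j).2)
      (Finset.mem_univ i)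
    rw [Finset.sum_sub_distrib, hp] at h
    simp at h
    linarith
  have hp0 : 0 ≤ p := div_nonneg (Finset.sum_nonneg fun i _ => (hX i).1) ht'.le
  have hp1 : p ≤ 1 := by
    have h := (sub_nonneg.2 (hX ⟨0, ht⟩).2).trans (hle' ⟨0, ht⟩)
    exact sub_nonneg.1 (nonneg_of_mul_nonneg_right h ht')
  have lower : (((t : ℝ) * bernoulliKL p μ : ℝ) : EReal)
      ≤ ⨆ β ∈ Set.Icc (-(1 / (1 - μ))) (1 / μ), ∑ i, elog (1 + β * (X i - μ)) := by
    have hmem : (p - μ) / (μ * (1 - μ)) ∈ Set.Icc (-(1 / (1 - μ))) (1 / μ) := by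
      constructor
      · rw [← neg_div, div_le_div_iff₀ hμ1' (mul_pos hμ0 hμ1')]
        nlinarith
      · rw [div_le_div_iff₀ (mul_pos hμ0 hμ1') hμ0]
        nlinarith
    refine le_trans ?_ (le_iSup₂ (f := fun β (_ : β ∈ Set.Icc (-(1 / (1 - μ))) (1 / μ)) =>
      ∑ i, elog (1 + β * (X i - μ))) _ hmem)
    rw [bernoulliKL, ← sum_mul_add_one_sub_mul hp, ereal_coe_sum]
    refine Finset.sum_le_sum fun i _ =>
      chord_le_elog_wealth hμ0 hμ1 hp0 hp1 (hX i).1 (hX i).2 (fun h => ?_) (fun h => ?_)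
    · have := hle i
      rw [h, mul_zero] at this
      exact le_antisymm this (hX i).1
    · have := hle' i
      rw [h, sub_self, mul_zero] at this
      exact le_antisymm (hX i).2 (sub_nonpos.1 this)
  refine ⟨lower, fun hbin => le_antisymm (iSup₂_le fun β hβ => ?_) lower⟩
  have ha : 0 ≤ 1 + β * (1 - μ) := by
    have h := hβ.1
    rw [← neg_div, div_le_iff₀ hμ1'] at h
    linarith
  have hb : 0 ≤ 1 - β * μ := by
    have h := hβ.2
    rw [le_div_iff₀ hμ0] at h
    linarith
  have tangent (i : Fin t) : elog (1 + β * (X i - μ)) ≤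
      ((X i * (Real.log (p / μ) + ((1 + β * (1 - μ)) / (p / μ) - 1)) + (1 - X i) *
        (Real.log ((1 - p) / (1 - μ)) + ((1 - β * μ) / ((1 - p) / (1 - μ)) - 1)) : ℝ) :
          EReal) := by
    rcases hbin i with h | h
    · have hq : 0 < 1 - p := by
        have := hle' i
        rw [h] at this
        exact pos_of_mul_pos_right (by linarith) ht'.le
      have := elog_le_tangent (1 + β * (X i - μ)) (div_pos hq hμ1')
      rw [h] at this ⊢
      convert this using 2
      ring
    · have hq : 0 < p := by
        have := hle i
        rw [h] at this
        exact pos_of_mul_pos_right (by linarith) ht'.le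
      have := elog_le_tangent (1 + β * (X i - μ)) (div_pos hq hμ0)
      rw [h] at this ⊢
      convert this using 2
      ring
  refine (Finset.sum_le_sum fun i _ => tangent i).trans ?_
  rw [← ereal_coe_sum, sum_mul_add_one_sub_mul hp, EReal.coe_le_coe_iff, bernoulliKL]
  refine mul_le_mul_of_nonneg_left ?_ ht'.le
  have h1 : p * ((1 + β * (1 - μ)) / (p / μ)) ≤ (1 + β * (1 - μ)) * μ := by
    calc p * ((1 + β * (1 - μ)) / (p / μ)) = (1 + β * (1 - μ)) * μ * (p / p) := by
          rw [div_div_eq_mul_div]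
          ring
      _ ≤ _ := mul_le_of_le_one_right (mul_nonneg ha hμ0.le) (div_self_le_one p)
  have h2 : (1 - p) * ((1 - β * μ) / ((1 - p) / (1 - μ))) ≤ (1 - β * μ) * (1 - μ) := by
    calc (1 - p) * ((1 - β * μ) / ((1 - p) / (1 - μ)))
        = (1 - β * μ) * (1 - μ) * ((1 - p) / (1 - p)) := by
          rw [div_div_eq_mul_div]
          ring
      _ ≤ _ := mul_le_of_le_one_right (mul_nonneg hb hμ1'.le) (div_self_le_one _)
  linarith
end

section
/- Let X_1,…,X_t ∈ [0,1] and μ̂_t = (1/t) Σ_{i=1}^t X_i. For m ∈ (0,1), define H(m) = sup_{β ∈ [-1/(1-m), 1/m]} Σ_{i=1}^t ln(1 + β (X_i - m)). Then H is nonincreasing on (0, μ̂_t) and nondecreasing on (μ̂_t, 1); in particular H is quasiconvex on (0,1). -/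
open scoped BigOperators

theorem elog_mono : Monotone elog := by
  intro x y h
  unfold elog
  split_ifs with hx hy hy
  · exact le_rfl
  · exact bot_le
  · exact absurd (h.trans hy) hx
  · exact EReal.coe_le_coe_iff.2 (Real.log_le_log (not_le.1 hx) h)

theorem elog_one_add_le (x : ℝ) : elog (1 + x) ≤ (x : EReal) := by
  unfold elog
  split_ifs with h
  · exact bot_le
  · exact EReal.coe_le_coe_iff.2
      (by linarith [Real.log_le_sub_one_of_pos (not_le.1 h)])

/-- The log-wealth after betting the constant fraction `β` against the mean `m`. -/
noncomputable def logWealth {t : ℕ} (X : Fin t → ℝ) (m β : ℝ) : EReal :=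
  ∑ i, elog (1 + β * (X i - m))

/-- The maximal log-wealth over all admissible constant betting fractions. -/
noncomputable def maxLogWealth {t : ℕ} (X : Fin t → ℝ) (m : ℝ) : EReal :=
  ⨆ β ∈ Set.Icc (-(1 / (1 - m))) (1 / m), logWealth X m β

section

variable {t : ℕ} {X : Fin t → ℝ} {m m' β : ℝ}

theorem logWealth_zero : logWealth X m 0 = 0 := by
  simp [logWealth, elog]

theorem logWealth_nonpos (h : β * (∑ i, X i - t * m) ≤ 0) : logWealth X m β ≤ 0 := by
  calc logWealth X m β ≤ ∑ i, ((β * (X i - m) : ℝ) : EReal) :=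
        Finset.sum_le_sum fun i _ => elog_one_add_le _
    _ = ((∑ i, β * (X i - m) : ℝ) : EReal) :=
        (map_sum (⟨⟨Real.toEReal, EReal.coe_zero⟩, EReal.coe_add⟩ : ℝ →+ EReal) _ _).symm
    _ ≤ 0 := by
        rw [← Finset.mul_sum, Finset.sum_sub_distrib]
        simpa using EReal.coe_le_coe_iff.2 h

theorem logWealth_le_logWealth (h : β * m ≤ β * m') : logWealth X m' β ≤ logWealth X m β :=
  Finset.sum_le_sum fun i _ => elog_mono (by linarith)

theorem logWealth_le_maxLogWealth (hβ : β ∈ Set.Icc (-(1 / (1 - m))) (1 / m)) :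
    logWealth X m β ≤ maxLogWealth X m :=
  le_iSup₂ (f := fun β (_ : β ∈ Set.Icc (-(1 / (1 - m))) (1 / m)) => logWealth X m β) β hβ

theorem neg_one_div_one_sub_nonpos (hm : m < 1) : -(1 / (1 - m)) ≤ 0 :=
  neg_nonpos.2 (one_div_pos.2 (sub_pos.2 hm)).le

theorem maxLogWealth_nonneg (h0 : 0 < m) (h1 : m < 1) : 0 ≤ maxLogWealth X m := by
  rw [← logWealth_zero (X := X) (m := m)]
  exact logWealth_le_maxLogWealth ⟨neg_one_div_one_sub_nonpos h1, (one_div_pos.2 h0).le⟩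

theorem maxLogWealth_le_of_le_mean (h0 : 0 < m) (hle : m ≤ m') (h1 : m' < 1)
    (hmean : t * m' ≤ ∑ i, X i) : maxLogWealth X m' ≤ maxLogWealth X m := by
  have hm1 : m < 1 := hle.trans_lt h1
  refine iSup₂_le fun β hβ => ?_
  rcases le_total β 0 with hneg | hpos
  · exact (logWealth_nonpos (mul_nonpos_of_nonpos_of_nonneg hneg (sub_nonneg.2 hmean))).trans
      (maxLogWealth_nonneg h0 hm1)
  · exact (logWealth_le_logWealth (mul_le_mul_of_nonneg_left hle hpos)).trans
      (logWealth_le_maxLogWealth ⟨(neg_one_div_one_sub_nonpos hm1).trans hpos,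
        hβ.2.trans (one_div_le_one_div_of_le h0 hle)⟩)

theorem maxLogWealth_le_of_mean_le (h0 : 0 < m') (hle : m' ≤ m) (h1 : m < 1)
    (hmean : ∑ i, X i ≤ t * m') : maxLogWealth X m' ≤ maxLogWealth X m := by
  have hm0 : 0 < m := h0.trans_le hle
  refine iSup₂_le fun β hβ => ?_
  rcases le_total 0 β with hpos | hneg
  · exact (logWealth_nonpos (mul_nonpos_of_nonneg_of_nonpos hpos (sub_nonpos.2 hmean))).trans
      (maxLogWealth_nonneg hm0 h1)
  · exact (logWealth_le_logWealth (mul_le_mul_of_nonpos_left hle hneg)).trans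
      (logWealth_le_maxLogWealth
        ⟨(neg_le_neg (one_div_le_one_div_of_le (sub_pos.2 h1)
          (sub_le_sub_left hle 1))).trans hβ.1,
        hneg.trans (one_div_pos.2 hm0).le⟩)

end

/-- For `X_1,…,X_t ∈ [0,1]` with empirical mean `μ̂`, the maximal log-wealth
`H(m) = sup_{β ∈ [-1/(1-m), 1/m]} Σ_i ln(1 + β (X_i - m))` (with `ln 0 = -∞`)
is nonincreasing on `(0, μ̂)`, nondecreasing on `(μ̂, 1)`, and hence
quasiconvex on `(0,1)`. -/
theorem max_log_wealth_quasiconvex (t : ℕ) (ht : 1 ≤ t) (X : Fin t → ℝ)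
    (hX : ∀ i, X i ∈ Set.Icc (0 : ℝ) 1) :
    AntitoneOn
      (fun m : ℝ =>
        ⨆ β ∈ Set.Icc (-(1 / (1 - m))) (1 / m), ∑ i, elog (1 + β * (X i - m)))
      (Set.Ioo 0 ((∑ i, X i) / t)) ∧
    MonotoneOn
      (fun m : ℝ =>
        ⨆ β ∈ Set.Icc (-(1 / (1 - m))) (1 / m), ∑ i, elog (1 + β * (X i - m)))
      (Set.Ioo ((∑ i, X i) / t) 1) ∧
    ∀ r : EReal, Convex ℝ {m ∈ Set.Ioo (0 : ℝ) 1 |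
      (⨆ β ∈ Set.Icc (-(1 / (1 - m))) (1 / m), ∑ i, elog (1 + β * (X i - m))) ≤ r} := by
  have ht0 : (0 : ℝ) < t := Nat.cast_pos.2 ht
  have hmean0 : 0 ≤ (∑ i, X i) / t :=
    div_nonneg (Finset.sum_nonneg fun i _ => (hX i).1) ht0.le
  have hmean1 : (∑ i, X i) / t ≤ 1 :=
    (div_le_one ht0).2 ((Finset.sum_le_sum fun i _ => (hX i).2).trans_eq (by simp))
  change AntitoneOn (maxLogWealth X) _ ∧ MonotoneOn (maxLogWealth X) _ ∧
    ∀ r : EReal, Convex ℝ {m ∈ Set.Ioo (0 : ℝ) 1 | maxLogWealth X m ≤ r}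
  refine ⟨fun a ha b hb hab => ?_, fun a ha b hb hab => ?_, fun r => ?_⟩
  · exact maxLogWealth_le_of_le_mean ha.1 hab (hb.2.trans_le hmean1)
      ((le_div_iff₀' ht0).1 hb.2.le)
  · exact maxLogWealth_le_of_mean_le (hmean0.trans_lt ha.1) hab hb.2
      ((div_le_iff₀' ht0).1 ha.1.le)
  · refine Set.OrdConnected.convex ⟨fun a ha b hb c hc => ?_⟩
    have hc0 : 0 < c := ha.1.1.trans_le hc.1
    have hc1 : c < 1 := hc.2.trans_lt hb.1.2
    refine ⟨⟨hc0, hc1⟩, ?_⟩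
    rcases le_total (t * c) (∑ i, X i) with h | h
    · exact (maxLogWealth_le_of_le_mean ha.1.1 hc.1 hc1 h).trans ha.2
    · exact (maxLogWealth_le_of_mean_le hc0 hc.2 hb.1.2 h).trans hb.2
end

section
/- Let t ≥ 1 be an integer and define f(b,k,t) = ln( b^k (1-b)^{t-k} Γ(t+1) Γ(1/2)² / ( Γ(k + 1/2) Γ(t-k + 1/2) ) ) for b ∈ [0,1] and integer k ∈ {0,…,t} (with 0^0 = 1 and ln 0 = -∞). Then for every b ∈ [0,1], the set of maximizers of k ↦ f(b,k,t) over k ∈ {0,…,t} is contained in { ⌈tb - 0.5⌉, ⌊tb + 0.5⌋ }; equivalently, an integer k* maximizes f(b,·,t) if and only if tb - 1/2 ≤ k* ≤ tb + 1/2. -/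
theorem elog_le_elog_iff {x y : ℝ} (hx : 0 ≤ x) (hy : 0 ≤ y) : elog x ≤ elog y ↔ x ≤ y := by
  rcases hx.eq_or_lt with rfl | hx
  · simp [elog, hy]
  rcases hy.eq_or_lt with rfl | hy
  · simp [elog, hx.not_ge]
  · simp [elog, hx.not_ge, hy.not_ge, Real.log_le_log_iff hx hy]

/-- The wealth ratio whose logarithm is the regret `f(b,k,t)`. -/
noncomputable def wealthRatio (t : ℕ) (b : ℝ) (k : ℕ) : ℝ :=
  b ^ k * (1 - b) ^ (t - k) * Real.Gamma (t + 1) * Real.Gamma (1 / 2) ^ 2 /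
    (Real.Gamma (k + 1 / 2) * Real.Gamma ((t : ℝ) - k + 1 / 2))

namespace wealthRatio

variable {t k l : ℕ} {b : ℝ}

theorem eq_mul_pos (b : ℝ) (hk : k ≤ t) :
    ∃ c : ℝ, 0 < c ∧ wealthRatio t b k = b ^ k * (1 - b) ^ (t - k) * c := by
  have hk' : (k : ℝ) ≤ t := by exact_mod_cast hk
  refine ⟨Real.Gamma (t + 1) * Real.Gamma (1 / 2) ^ 2 /
    (Real.Gamma (k + 1 / 2) * Real.Gamma ((t : ℝ) - k + 1 / 2)), ?_, ?_⟩
  · have h₁ := Real.Gamma_pos_of_pos (s := (t : ℝ) + 1) (by positivity)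
    have h₂ := Real.Gamma_pos_of_pos (s := (1 / 2 : ℝ)) (by norm_num)
    have h₃ := Real.Gamma_pos_of_pos (s := (k : ℝ) + 1 / 2) (by positivity)
    have h₄ := Real.Gamma_pos_of_pos (s := (t : ℝ) - k + 1 / 2) (by linarith)
    positivity
  · rw [wealthRatio]
    ring

theorem nonneg (hb : b ∈ Set.Icc (0 : ℝ) 1) (hk : k ≤ t) : 0 ≤ wealthRatio t b k := by
  obtain ⟨c, hc, h⟩ := eq_mul_pos b hk
  have := hb.1
  have := sub_nonneg.2 hb.2
  rw [h]
  positivity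

theorem pos (hb : b ∈ Set.Ioo (0 : ℝ) 1) (hk : k ≤ t) : 0 < wealthRatio t b k := by
  obtain ⟨c, hc, h⟩ := eq_mul_pos b hk
  have := hb.1
  have := sub_pos.2 hb.2
  rw [h]
  positivity

theorem zero_right_pos (t : ℕ) : 0 < wealthRatio t 0 0 := by
  obtain ⟨c, hc, h⟩ := eq_mul_pos 0 (Nat.zero_le t)
  simpa [h] using hc

theorem zero_right_eq_zero (hk : k ≤ t) (h0 : k ≠ 0) : wealthRatio t 0 k = 0 := by
  obtain ⟨c, -, h⟩ := eq_mul_pos 0 hk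
  simp [h, h0]

theorem one_right_pos (t : ℕ) : 0 < wealthRatio t 1 t := by
  obtain ⟨c, hc, h⟩ := eq_mul_pos 1 (le_refl t)
  simpa [h] using hc

theorem one_right_eq_zero (hk : k < t) : wealthRatio t 1 k = 0 := by
  obtain ⟨c, -, h⟩ := eq_mul_pos 1 hk.le
  simp [h, Nat.sub_ne_zero_of_lt hk]

theorem succ_mul (b : ℝ) (hk : k < t) :
    wealthRatio t b (k + 1) * ((1 - b) * (k + 1 / 2)) =
      wealthRatio t b k * (b * ((t : ℝ) - k - 1 / 2)) := by
  have hk' : (k : ℝ) + 1 ≤ t := by exact_mod_cast hk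
  have hx : (0 : ℝ) < k + 1 / 2 := by positivity
  have hy : (0 : ℝ) < (t : ℝ) - k - 1 / 2 := by linarith
  have e₁ : Real.Gamma (((k + 1 : ℕ) : ℝ) + 1 / 2) = (k + 1 / 2) * Real.Gamma (k + 1 / 2) := by
    rw [← Real.Gamma_add_one hx.ne']
    push_cast
    ring_nf
  have e₂ : Real.Gamma ((t : ℝ) - k + 1 / 2) =
      ((t : ℝ) - k - 1 / 2) * Real.Gamma ((t : ℝ) - k - 1 / 2) := by
    rw [← Real.Gamma_add_one hy.ne']
    ring_nf
  have e₃ : (t : ℝ) - ((k + 1 : ℕ) : ℝ) + 1 / 2 = (t : ℝ) - k - 1 / 2 := by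
    push_cast
    ring
  have e₄ : (1 - b) ^ (t - k) = (1 - b) ^ (t - (k + 1)) * (1 - b) := by
    rw [← pow_succ]
    congr 1
    omega
  have h₁ := (Real.Gamma_pos_of_pos hx).ne'
  have h₂ := (Real.Gamma_pos_of_pos hy).ne'
  rw [wealthRatio, wealthRatio, e₁, e₃, e₂, e₄, pow_succ]
  generalize Real.Gamma ((k : ℝ) + 1 / 2) = A at *
  generalize Real.Gamma ((t : ℝ) - k - 1 / 2) = B at *
  generalize (k : ℝ) + 1 / 2 = x at *
  generalize (t : ℝ) - k - 1 / 2 = y at *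
  have hx' := hx.ne'
  have hy' := hy.ne'
  field_simp

theorem lt_succ_iff (hb : b ∈ Set.Ioo (0 : ℝ) 1) (hk : k < t) :
    wealthRatio t b k < wealthRatio t b (k + 1) ↔ (k : ℝ) + 1 / 2 < t * b := by
  have hc : 0 < (1 - b) * ((k : ℝ) + 1 / 2) := mul_pos (sub_pos.2 hb.2) (by positivity)
  rw [← mul_lt_mul_iff_left₀ hc, succ_mul b hk, mul_lt_mul_iff_right₀ (pos hb hk.le)]
  constructor <;> intro h <;> linarith

theorem succ_lt_iff (hb : b ∈ Set.Ioo (0 : ℝ) 1) (hk : k < t) :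
    wealthRatio t b (k + 1) < wealthRatio t b k ↔ t * b < (k : ℝ) + 1 / 2 := by
  have hc : 0 < (1 - b) * ((k : ℝ) + 1 / 2) := mul_pos (sub_pos.2 hb.2) (by positivity)
  rw [← mul_lt_mul_iff_left₀ hc, succ_mul b hk, mul_lt_mul_iff_right₀ (pos hb hk.le)]
  constructor <;> intro h <;> linarith

theorem le_of_le_mul_add_half (hb : b ∈ Set.Ioo (0 : ℝ) 1) (hl : l ≤ t)
    (h : (l : ℝ) ≤ t * b + 1 / 2) (hkl : k ≤ l) : wealthRatio t b k ≤ wealthRatio t b l := by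
  induction l, hkl using Nat.le_induction with
  | base => exact le_rfl
  | succ j _ ih =>
    push_cast at h
    refine (ih (by omega) (by linarith)).trans (not_lt.1 fun hlt => ?_)
    linarith [(succ_lt_iff hb hl).1 hlt]

theorem le_of_mul_sub_half_le (hb : b ∈ Set.Ioo (0 : ℝ) 1) (hl : l ≤ t)
    (h : (t : ℝ) * b - 1 / 2 ≤ k) (hkl : k ≤ l) : wealthRatio t b l ≤ wealthRatio t b k := by
  induction l, hkl using Nat.le_induction with
  | base => exact le_rfl
  | succ j hj ih =>
    refine (not_lt.1 fun hlt => ?_).trans (ih (by omega))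
    have hj' : (k : ℝ) ≤ j := by exact_mod_cast hj
    linarith [(lt_succ_iff hb hl).1 hlt]

theorem isMax_iff_of_mem_Ioo (hb : b ∈ Set.Ioo (0 : ℝ) 1) (hl : l ≤ t) :
    (∀ k ≤ t, wealthRatio t b k ≤ wealthRatio t b l) ↔
      ((t : ℝ) * b - 1 / 2 ≤ l ∧ (l : ℝ) ≤ t * b + 1 / 2) := by
  refine ⟨fun h => ⟨not_lt.1 fun hlt => ?_, not_lt.1 fun hlt => ?_⟩, fun h k hk => ?_⟩
  · rcases hl.eq_or_lt with rfl | hl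
    · nlinarith [hb.2, Nat.cast_nonneg (α := ℝ) l]
    · exact ((lt_succ_iff hb hl).2 (by linarith)).not_ge (h _ hl)
  · cases l with
    | zero =>
      push_cast at hlt
      nlinarith [mul_nonneg (Nat.cast_nonneg (α := ℝ) t) hb.1.le]
    | succ j =>
      push_cast at hlt
      exact ((succ_lt_iff hb hl).2 (by linarith)).not_ge (h _ (by omega))
  · rcases le_total k l with hkl | hkl
    · exact le_of_le_mul_add_half hb hl h.2 hkl
    · exact le_of_mul_sub_half_le hb hk h.1 hkl

theorem isMax_zero_right_iff (hl : l ≤ t) :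
    (∀ k ≤ t, wealthRatio t 0 k ≤ wealthRatio t 0 l) ↔ l = 0 := by
  constructor
  · intro h
    by_contra h0
    have := h 0 (Nat.zero_le t)
    rw [zero_right_eq_zero hl h0] at this
    exact this.not_gt (zero_right_pos t)
  · rintro rfl k hk
    rcases eq_or_ne k 0 with rfl | h0
    · exact le_rfl
    · rw [zero_right_eq_zero hk h0]
      exact (zero_right_pos t).le

theorem isMax_one_right_iff (hl : l ≤ t) :
    (∀ k ≤ t, wealthRatio t 1 k ≤ wealthRatio t 1 l) ↔ l = t := by
  constructor
  · intro h
    by_contra h0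
    have := h t le_rfl
    rw [one_right_eq_zero (lt_of_le_of_ne hl h0)] at this
    exact this.not_gt (one_right_pos t)
  · rintro rfl k hk
    rcases hk.eq_or_lt with rfl | hk
    · exact le_rfl
    · rw [one_right_eq_zero hk]
      exact (one_right_pos l).le

theorem isMax_iff (hb : b ∈ Set.Icc (0 : ℝ) 1) (hl : l ≤ t) :
    (∀ k ≤ t, wealthRatio t b k ≤ wealthRatio t b l) ↔
      ((t : ℝ) * b - 1 / 2 ≤ l ∧ (l : ℝ) ≤ t * b + 1 / 2) := by
  rcases hb.1.eq_or_lt with rfl | hb₀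
  · rw [isMax_zero_right_iff hl]
    constructor
    · rintro rfl
      norm_num
    · rintro ⟨-, h⟩
      have : (l : ℝ) < 1 := by linarith
      exact Nat.lt_one_iff.1 (by exact_mod_cast this)
  rcases hb.2.eq_or_lt with rfl | hb₁
  · rw [isMax_one_right_iff hl]
    constructor
    · rintro rfl
      constructor <;> linarith
    · rintro ⟨h, -⟩
      have : (t : ℝ) < l + 1 := by linarith
      exact le_antisymm hl (Nat.lt_succ_iff.1 (by exact_mod_cast this))
  · exact isMax_iff_of_mem_Ioo ⟨hb₀, hb₁⟩ hl

end wealthRatio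

/-- For `t ≥ 1`, `b ∈ [0,1]` and
`f(b,k,t) = ln( b^k (1-b)^{t-k} Γ(t+1) Γ(1/2)² / (Γ(k+1/2) Γ(t-k+1/2)) )`
(with `ln 0 = -∞`), an integer `k* ∈ {0,…,t}` maximizes `k ↦ f(b,k,t)` over
`{0,…,t}` if and only if `t b - 1/2 ≤ k* ≤ t b + 1/2`. -/
theorem regret_bound_argmax (t : ℕ) (ht : 1 ≤ t) (b : ℝ)
    (hb : b ∈ Set.Icc (0 : ℝ) 1) (k' : ℕ) (hk' : k' ≤ t) :
    (∀ k ≤ t,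
        elog (b ^ k * (1 - b) ^ (t - k) * Real.Gamma (t + 1) *
            Real.Gamma (1 / 2) ^ 2 /
          (Real.Gamma (k + 1 / 2) * Real.Gamma ((t : ℝ) - k + 1 / 2)))
          ≤ elog (b ^ k' * (1 - b) ^ (t - k') * Real.Gamma (t + 1) *
              Real.Gamma (1 / 2) ^ 2 /
            (Real.Gamma (k' + 1 / 2) * Real.Gamma ((t : ℝ) - k' + 1 / 2))))
      ↔ ((t : ℝ) * b - 1 / 2 ≤ k' ∧ (k' : ℝ) ≤ (t : ℝ) * b + 1 / 2) := by
  rw [← wealthRatio.isMax_iff hb hk']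
  exact forall₂_congr fun k hk =>
    elog_le_elog_iff (wealthRatio.nonneg hb hk) (wealthRatio.nonneg hb hk')
end

section
/- Let A ∈ ℝ and B > 0, and define f(x) = A·x + B·( ln(1 - |x|) + |x| ) for x ∈ (-1,1) (extended by f(±1) = A·(±1) - ∞·[B>0]). Then f attains its maximum over [-1,1] at x* = A/(|A| + B), the maximum value is B·ψ(A/B) where ψ(u) = |u| - ln(|u| + 1), and moreover B·ψ(A/B) ≥ A² / ( (4/3)|A| + 2B ). -/
theorem elog_of_pos {x : ℝ} (hx : 0 < x) : elog x = ((Real.log x : ℝ) : EReal) :=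
  if_neg hx.not_ge

/-- A Padé-type upper bound for `ln (1 + u)`. -/
theorem log_one_add_le_div {u : ℝ} (hu : 0 ≤ u) :
    Real.log (1 + u) ≤ u * (6 + u) / (6 + 4 * u) := by
  have hd : ∀ t : ℝ, 0 ≤ t → HasDerivAt
      (fun t : ℝ => t * (6 + t) / (6 + 4 * t) - Real.log (1 + t))
      (4 * t ^ 3 / ((6 + 4 * t) ^ 2 * (1 + t))) t := by
    intro t ht
    have h1 : (6 + 4 * t) ≠ 0 := by positivity
    have h2 : (1 + t) ≠ 0 := by positivity
    have hn := (hasDerivAt_id t).mul ((hasDerivAt_id t).const_add 6)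
    have hq := ((hasDerivAt_id t).const_mul 4).const_add 6
    have hl := ((hasDerivAt_id t).const_add 1).log h2
    refine ((hn.div hq h1).sub hl).congr_deriv ?_
    simp only [id, Pi.mul_apply]
    field_simp
    ring
  have hmono : MonotoneOn (fun t : ℝ => t * (6 + t) / (6 + 4 * t) - Real.log (1 + t))
      (Set.Ici 0) := by
    refine monotoneOn_of_deriv_nonneg (convex_Ici 0)
      (fun t ht => (hd t ht).continuousAt.continuousWithinAt)
      (fun t ht => (hd t (interior_subset ht)).differentiableAt.differentiableWithinAt) ?_
    intro t ht
    have ht0 : 0 ≤ t := interior_subset (s := Set.Ici (0 : ℝ)) ht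
    rw [(hd t ht0).deriv]
    positivity
  have h := hmono Set.self_mem_Ici hu hu
  simp only [zero_mul, zero_div, add_zero, Real.log_one, sub_zero] at h
  linarith

/-- For `A ∈ ℝ` and `B > 0`, the function
`f(x) = A x + B (ln(1 - |x|) + |x|)` (with `ln 0 = -∞` at `x = ±1`) attains
its maximum over `[-1,1]` at `x* = A/(|A| + B)`, the maximum value equals
`B ψ(A/B)` where `ψ(u) = |u| - ln(|u| + 1)`, and moreover
`B ψ(A/B) ≥ A² / ((4/3)|A| + 2B)`. -/
theorem max_approx_wealth (A B : ℝ) (hB : 0 < B) :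
    A / (|A| + B) ∈ Set.Icc (-1 : ℝ) 1 ∧
    (∀ x ∈ Set.Icc (-1 : ℝ) 1,
      ((A * x + B * |x| : ℝ) : EReal) + (B : EReal) * elog (1 - |x|)
        ≤ ((A * (A / (|A| + B)) + B * |A / (|A| + B)| : ℝ) : EReal)
            + (B : EReal) * elog (1 - |A / (|A| + B)|)) ∧
    ((A * (A / (|A| + B)) + B * |A / (|A| + B)| : ℝ) : EReal)
        + (B : EReal) * elog (1 - |A / (|A| + B)|)
      = ((B * (|A / B| - Real.log (|A / B| + 1)) : ℝ) : EReal) ∧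
    A ^ 2 / ((4 / 3) * |A| + 2 * B)
      ≤ B * (|A / B| - Real.log (|A / B| + 1)) := by
  have hS : 0 < |A| + B := by positivity
  have habs : |A / (|A| + B)| = |A| / (|A| + B) := by rw [abs_div, abs_of_pos hS]
  have hdiv : |A / B| = |A| / B := by rw [abs_div, abs_of_pos hB]
  have hs : 1 - |A| / (|A| + B) = B / (|A| + B) := by field_simp; ring
  have hspos : 0 < B / (|A| + B) := by positivity
  have hval : A * (A / (|A| + B)) + B * (|A| / (|A| + B)) = |A| := by
    field_simp
    rw [← sq_abs A]
    ring
  rw [habs, hs, hval, elog_of_pos hspos, hdiv]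
  refine ⟨?_, fun x _ => ?_, ?_, ?_⟩
  · rw [Set.mem_Icc, ← abs_le, habs, div_le_one hS]
    linarith
  · rcases le_or_gt (1 - |x|) 0 with hy | hy
    · rw [elog, if_pos hy, EReal.coe_mul_bot_of_pos hB, EReal.add_bot]
      exact bot_le
    · rw [elog_of_pos hy]
      norm_cast
      have hlog := Real.log_le_sub_one_of_pos (div_pos hy hspos)
      rw [Real.log_div hy.ne' hspos.ne'] at hlog
      have hscale := mul_le_mul_of_nonneg_left hlog hB.le
      have hrw : B * ((1 - |x|) / (B / (|A| + B)) - 1) = (1 - |x|) * (|A| + B) - B := by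
        field_simp
      rw [hrw] at hscale
      have hAx : A * x ≤ |A| * |x| := (le_abs_self _).trans_eq (abs_mul A x)
      linarith
  · have hinv : B / (|A| + B) = (|A| / B + 1)⁻¹ := by field_simp
    rw [hinv, Real.log_inv]
    norm_cast
    field_simp
    ring
  · have hlog := log_one_add_le_div (u := |A| / B) (by positivity)
    rw [add_comm] at hlog
    calc A ^ 2 / (4 / 3 * |A| + 2 * B)
        = B * (|A| / B - |A| / B * (6 + |A| / B) / (6 + 4 * (|A| / B))) := by
          rw [← sq_abs A]
          field_simp
          ring
      _ ≤ B * (|A| / B - Real.log (|A| / B + 1)) := by gcongr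
end

section
/- Let A > 0 and B ∈ ℝ satisfy ln A + B/A ≥ 1, and let x > 0 satisfy x ≤ A ln x + B. Then x ≤ A ln A + B + A √( 2 ( ln A + B/A - 1 ) ). -/
/-- Normalized form: `t - log t ≤ 1 + s² / 2` forces `t ≤ 1 + s + s² / 2`. -/
theorem le_quadratic_of_sub_log_le {s t : ℝ} (hs : 0 ≤ s) (ht : 0 < t)
    (h : t - Real.log t ≤ 1 + s ^ 2 / 2) : t ≤ 1 + s + s ^ 2 / 2 := by
  by_contra! hlt
  set q : ℝ := 1 + s + s ^ 2 / 2 with hq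
  have hq1 : 1 ≤ q := by rw [hq]; nlinarith [sq_nonneg s]
  have hq0 : 0 < q := by linarith
  have hlogq : Real.log q ≤ s :=
    (Real.log_le_iff_le_exp hq0).2 (Real.quadratic_le_exp_of_nonneg hs)
  have hratio : Real.log (t / q) < t / q - 1 :=
    Real.log_lt_sub_one_of_pos (div_pos ht hq0) ((one_lt_div hq0).2 hlt).ne'
  have hdiv : t / q - 1 ≤ t - q := by
    rw [div_sub_one hq0.ne']
    exact div_le_self (by linarith) hq1
  rw [Real.log_div ht.ne' hq0.ne'] at hratio
  linarith

/-- If `A > 0`, `ln A + B/A ≥ 1`, `x > 0` and `x ≤ A ln x + B`, then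
`x ≤ A ln A + B + A √(2 (ln A + B/A - 1))`. -/
theorem log_implicit_inversion (A B x : ℝ) (hA : 0 < A)
    (hAB : 1 ≤ Real.log A + B / A) (hx : 0 < x)
    (h : x ≤ A * Real.log x + B) :
    x ≤ A * Real.log A + B + A * Real.sqrt (2 * (Real.log A + B / A - 1)) := by
  have hsq := Real.sq_sqrt (show 0 ≤ 2 * (Real.log A + B / A - 1) by linarith)
  set s := Real.sqrt (2 * (Real.log A + B / A - 1))
  have hxA : x / A ≤ Real.log x + B / A := by
    rw [div_le_iff₀ hA, add_mul, div_mul_cancel₀ _ hA.ne']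
    linarith
  have key : x / A ≤ 1 + s + s ^ 2 / 2 := by
    refine le_quadratic_of_sub_log_le (Real.sqrt_nonneg _) (div_pos hx hA) ?_
    rw [Real.log_div hx.ne' hA.ne']
    linarith
  calc x ≤ (1 + s + s ^ 2 / 2) * A := (div_le_iff₀ hA).1 key
    _ = A * Real.log A + B + A * s := by
      rw [hsq]
      field_simp
      ring
end
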